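/- For every k ≥ 1 there exists θ_c > 0, depending only on k, with the following property: if σ ∈ S_k is a pattern and μ ∈ ℳ is CNC with respect to σ, then for each θ ∈ (−θ_c,θ_c) the supremum sup_{ν∈ℳ}{θ t_σ(ν) − D(ν|μ)} has a unique maximizer ν_θ, and moreover (i) ν_θ ≠ μ whenever θ ≠ 0, and (ii) t_σ(ν_θ) > t_σ(μ) for θ ∈ (0,θ_c) and t_σ(ν_θ) < t_σ(μ) for θ ∈ (−θ_c,0). -/

import Mathlib

open MeasureTheory Filter Topology
open scoped ENNReal

noncomputable section

/-- The plane `ℝ²`, carrier for measures on the unit square. -/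
abbrev Ω2 : Type := ℝ × ℝ

/-- The unit square `[0,1]² ⊆ ℝ²`. -/
def unitSq : Set Ω2 := Set.Icc (0 : ℝ) 1 ×ˢ Set.Icc (0 : ℝ) 1

/-- Lebesgue measure on the unit square. -/
def lebSq : Measure Ω2 := volume.restrict unitSq

/-- `𝒫`: Borel probability measures concentrated on the unit square. -/
def Pcal : Set (ProbabilityMeasure Ω2) := {μ | (μ : Measure Ω2) unitSq = 1}

/-- `ℳ`: members of `𝒫` whose two coordinate marginals are atomless
(equivalently, have continuous CDFs). -/
def Mcal : Set (ProbabilityMeasure Ω2) :=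
  {μ | μ ∈ Pcal ∧ (∀ x : ℝ, (μ : Measure Ω2).map Prod.fst {x} = 0) ∧
      ∀ y : ℝ, (μ : Measure Ω2).map Prod.snd {y} = 0}

/-- The uniform distribution on `[0,1]`. -/
def unif01 : Measure ℝ := volume.restrict (Set.Icc (0 : ℝ) 1)

/-- `ℳ̃`: permutons, i.e. members of `𝒫` with both marginals uniform on `[0,1]`. -/
def Mtilde : Set (ProbabilityMeasure Ω2) :=
  {μ | μ ∈ Pcal ∧ (μ : Measure Ω2).map Prod.fst = unif01 ∧
      (μ : Measure Ω2).map Prod.snd = unif01}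

open scoped Classical in
/-- `h_σ`: indicator that the `k` points induce the pattern `σ`. -/
def hPat {k : ℕ} (σ : Equiv.Perm (Fin k)) (z : Fin k → Ω2) : ℝ :=
  if ∃ τ : Equiv.Perm (Fin k),
      StrictMono (fun i => (z (τ i)).1) ∧ StrictMono (fun i => (z (τ (σ⁻¹ i))).2)
  then 1 else 0

/-- Pattern density `t_σ(ν) = ∫ h_σ dν^{⊗k}`. -/
def tPat {k : ℕ} (σ : Equiv.Perm (Fin k)) (ν : Measure Ω2) : ℝ :=
  ∫ z, hPat σ z ∂(Measure.pi fun _ : Fin k => ν)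

open scoped Classical in
/-- The permutation induced by `n` labelled points of `ℝ²` (junk value `1` if the
coordinates are not in generic position). -/
def inducedPerm {n : ℕ} (z : Fin n → Ω2) : Equiv.Perm (Fin n) :=
  if h : ∃ σ : Equiv.Perm (Fin n), hPat σ z = 1 then h.choose else 1

/-- Empirical measure `Em(π) = (1/n) ∑ δ_{(i/n, π(i)/n)}` of a permutation, as a measure. -/
def EmM {n : ℕ} (π : Equiv.Perm (Fin n)) : Measure Ω2 :=
  (n : ℝ≥0∞)⁻¹ • ∑ i : Fin n, Measure.dirac ((((i : ℕ) + 1 : ℝ)) / n, (((π i : ℕ) + 1 : ℝ)) / n)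

open scoped Classical in
/-- Empirical measure of a permutation as a probability measure (junk value for `n = 0`). -/
def EmP {n : ℕ} (π : Equiv.Perm (Fin n)) : ProbabilityMeasure Ω2 :=
  if h : IsProbabilityMeasure (EmM π) then ⟨EmM π, h⟩
  else ⟨Measure.dirac 0, by infer_instance⟩

/-- `t_σ(π) := t_σ(Em(π))`. -/
def tPerm {k n : ℕ} (σ : Equiv.Perm (Fin k)) (π : Equiv.Perm (Fin n)) : ℝ := tPat σ (EmM π)

open scoped Classical in
/-- Kullback–Leibler divergence `D(ν|μ) ∈ [0,∞]`; for probability measures with `ν ≪ μ`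
it equals `∫ log(dν/dμ) dν`, written here through the nonnegative integrand
`g log g + 1 - g` of the density `g = dν/dμ` (the correction `∫ (1-g) dμ = 0`). -/
def KL (ν μ : Measure Ω2) : ℝ≥0∞ :=
  if ν ≪ μ then
    ∫⁻ z, ENNReal.ofReal ((ν.rnDeriv μ z).toReal * Real.log ((ν.rnDeriv μ z).toReal)
      + 1 - (ν.rnDeriv μ z).toReal) ∂μ
  else ∞

/-- CDF of the first marginal. -/
def cdfX (μ : Measure Ω2) (x : ℝ) : ℝ := (μ {p : Ω2 | p.1 ≤ x}).toReal

/-- CDF of the second marginal. -/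
def cdfY (μ : Measure Ω2) (y : ℝ) : ℝ := (μ {p : Ω2 | p.2 ≤ y}).toReal

/-- The map `𝒪`: pushforward of `μ` under `(x,y) ↦ (F₁(x), F₂(y))`. -/
def Omap (μ : Measure Ω2) : Measure Ω2 := μ.map fun p => (cdfX μ p.1, cdfY μ p.2)

/-- The product measure `μ^{⊗n}` governing `n` i.i.d. samples. -/
def pmeas (μ : Measure Ω2) (n : ℕ) : Measure (Fin n → Ω2) := Measure.pi fun _ => μ

/-- Log-partition function `F_n(σ,μ,θ) = log E[exp(nθ t_σ(π_{n,μ}))]`. -/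
def Fn {k : ℕ} (σ : Equiv.Perm (Fin k)) (μ : Measure Ω2) (θ : ℝ) (n : ℕ) : ℝ :=
  Real.log (∫ z, Real.exp (n * θ * tPerm σ (inducedPerm z)) ∂pmeas μ n)

/-- The Gibbs measure `Q_{n,σ,μ,θ}` on `([0,1]²)ⁿ`. -/
def Qgibbs {k : ℕ} (σ : Equiv.Perm (Fin k)) (μ : Measure Ω2) (θ : ℝ) (n : ℕ) :
    Measure (Fin n → Ω2) :=
  (pmeas μ n).withDensity fun z =>
    ENNReal.ofReal (Real.exp (n * θ * tPerm σ (inducedPerm z) - Fn σ μ θ n))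

/-- `F(σ,μ,θ) = sup_{ν ∈ ℳ} { θ t_σ(ν) − D(ν|μ) }`, valued in `EReal`. -/
def Fsup {k : ℕ} (σ : Equiv.Perm (Fin k)) (μ : Measure Ω2) (θ : ℝ) : EReal :=
  ⨆ ν ∈ Mcal, (((θ * tPat σ (ν : Measure Ω2) : ℝ) : EReal) - ((KL (↑ν) μ : ℝ≥0∞) : EReal))

/-- `ℱ(σ,μ,θ)`: the set of maximizers of `ν ↦ θ t_σ(ν) − D(ν|μ)` over `ℳ`. -/
def Fset {k : ℕ} (σ : Equiv.Perm (Fin k)) (μ : Measure Ω2) (θ : ℝ) :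
    Set (ProbabilityMeasure Ω2) :=
  {ν | ν ∈ Mcal ∧
    (((θ * tPat σ (ν : Measure Ω2) : ℝ) : EReal) - ((KL (↑ν) μ : ℝ≥0∞) : EReal)) = Fsup σ μ θ}

/-- `G(σ,μ,δ) = inf { D(ν|μ) : ν ∈ ℳ, t_σ(ν) ≥ δ }`. -/
def Gfun {k : ℕ} (σ : Equiv.Perm (Fin k)) (μ : Measure Ω2) (δ : ℝ) : ℝ≥0∞ :=
  ⨅ ν ∈ {ν : ProbabilityMeasure Ω2 | ν ∈ Mcal ∧ δ ≤ tPat σ (ν : Measure Ω2)}, KL (↑ν) μ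

/-- `𝒢(σ,μ,δ)`: the set of minimizers in the definition of `G(σ,μ,δ)`. -/
def Gset {k : ℕ} (σ : Equiv.Perm (Fin k)) (μ : Measure Ω2) (δ : ℝ) :
    Set (ProbabilityMeasure Ω2) :=
  {ν | (ν ∈ Mcal ∧ δ ≤ tPat σ (ν : Measure Ω2)) ∧ KL (↑ν) μ = Gfun σ μ δ}

/-- `α_σ(μ) = inf {δ : G(σ,μ,δ) = ∞}`. -/
def alphaSig {k : ℕ} (σ : Equiv.Perm (Fin k)) (μ : Measure Ω2) : ℝ :=
  sInf {δ : ℝ | Gfun σ μ δ = ∞}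

/-- `μ` is conditionally constant (CC) with respect to a pattern `σ` of size `k+1`:
the conditional probability `P(π_{X,Y} = σ | (X₁,Y₁))`, which for i.i.d. samples equals
`z ↦ ∫ h_σ(z, w) dμ^{⊗k}(w)`, is `μ`-a.s. equal to a constant `c ∈ [0,1]`. -/
def IsCC {k : ℕ} (σ : Equiv.Perm (Fin (k + 1))) (μ : Measure Ω2) : Prop :=
  ∃ c ∈ Set.Icc (0 : ℝ) 1, ∀ᵐ z ∂μ,
    (∫ w : Fin k → Ω2, hPat σ (Fin.cons z w) ∂pmeas μ k) = c

/-- The inversion pattern `21 ∈ S₂`. -/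
def inv2 : Equiv.Perm (Fin 2) := Equiv.swap 0 1

/-- Lévy–Prokhorov (extended) distance between measures on `ℝ²`. -/
def dLPE (μ ν : Measure Ω2) : ℝ≥0∞ := levyProkhorovEDist μ ν

/-- The topological support of a measure: the points whose every open neighbourhood
has positive measure. -/
def msupport (μ : Measure Ω2) : Set Ω2 :=
  {z | ∀ U : Set Ω2, IsOpen U → z ∈ U → 0 < μ U}


section MultilinearForms

variable {Ω : Type*} [MeasurableSpace Ω]

/-- The multilinear form `∫ h ∏ fᵢ` in which the slots in `S` are filled with `d` and the
others with `a`. -/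
def mixedForm {n : ℕ} (μ : Measure Ω) (h : (Fin n → Ω) → ℝ) (S : Finset (Fin n))
    (d a : Ω → ℝ) : ℝ :=
  ∫ z, h z * ∏ i, (if i ∈ S then d else a) (z i) ∂(Measure.pi fun _ : Fin n => μ)

/-- The diagonal `f ↦ ∫ h ∏ f(zᵢ)` of the multilinear form with kernel `h`. -/
def diagForm {n : ℕ} (μ : Measure Ω) (h : (Fin n → Ω) → ℝ) (f : Ω → ℝ) : ℝ :=
  ∫ z, h z * ∏ i, f (z i) ∂(Measure.pi fun _ : Fin n => μ)

/-- The part of `diagForm μ h (a + d)` which is linear in `d`. -/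
def linForm {n : ℕ} (μ : Measure Ω) (h : (Fin n → Ω) → ℝ) (d a : Ω → ℝ) : ℝ :=
  ∑ S : Finset (Fin n), if S.card = 1 then mixedForm μ h S d a else 0

variable {μ : Measure Ω} {n : ℕ} {h : (Fin n → Ω) → ℝ} {a d : Ω → ℝ}

lemma integrable_ite_mem (hd : Integrable d μ) (ha : Integrable a μ) (S : Finset (Fin n))
    (i : Fin n) : Integrable (if i ∈ S then d else a) μ := by
  split_ifs <;> assumption

lemma mixedForm_empty : mixedForm μ h ∅ d a = diagForm μ h a := by
  simp [mixedForm, diagForm]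

lemma linForm_neg : linForm μ h (-d) a = -linForm μ h d a := by
  rw [linForm, linForm, ← Finset.sum_neg_distrib]
  refine Finset.sum_congr rfl fun S _ => ?_
  split_ifs with hS
  · obtain ⟨j, rfl⟩ := Finset.card_eq_one.1 hS
    rw [mixedForm, mixedForm, ← integral_neg]
    refine integral_congr_ae (ae_of_all _ fun z => ?_)
    simp only [← Finset.mul_prod_erase Finset.univ _ (Finset.mem_univ j), Finset.mem_singleton,
      if_true, Pi.neg_apply]
    have : ∀ e : Ω → ℝ, ∏ i ∈ Finset.univ.erase j, (if i = j then e else a) (z i) =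
        ∏ i ∈ Finset.univ.erase j, a (z i) := fun e =>
      Finset.prod_congr rfl fun i hi => by rw [if_neg (Finset.ne_of_mem_erase hi)]
    rw [this, this]
    ring
  · simp

variable [IsProbabilityMeasure μ]

lemma integrable_kernel_mul_prod (hm : Measurable h) (hb : ∀ z, |h z| ≤ 1) {f : Fin n → Ω → ℝ}
    (hf : ∀ i, Integrable (f i) μ) :
    Integrable (fun z => h z * ∏ i, f i (z i)) (Measure.pi fun _ : Fin n => μ) :=
  (Integrable.fintype_prod_dep hf).bdd_mul (c := 1) hm.aestronglyMeasurable
    (ae_of_all _ fun z => by simpa using hb z)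

lemma abs_mixedForm_le (hm : Measurable h) (hb : ∀ z, |h z| ≤ 1) (hd : Integrable d μ)
    (ha : Integrable a μ) (ha1 : ∫ x, |a x| ∂μ ≤ 1) (S : Finset (Fin n)) :
    |mixedForm μ h S d a| ≤ (∫ x, |d x| ∂μ) ^ S.card := by
  have hi := integrable_ite_mem hd ha S
  calc |mixedForm μ h S d a|
      ≤ ∫ z, |h z * ∏ i, (if i ∈ S then d else a) (z i)| ∂(Measure.pi fun _ : Fin n => μ) :=
        abs_integral_le_integral_abs
    _ ≤ ∫ z, ∏ i, |(if i ∈ S then d else a) (z i)| ∂(Measure.pi fun _ : Fin n => μ) := by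
        refine integral_mono (integrable_kernel_mul_prod hm hb hi).abs
          (Integrable.fintype_prod_dep fun i => (hi i).abs) fun z => ?_
        simp only [abs_mul, Finset.abs_prod]
        exact mul_le_of_le_one_left (by positivity) (hb z)
    _ = ∏ i, ∫ x, |(if i ∈ S then d else a) x| ∂μ :=
        integral_fintype_prod_eq_prod (fun i x => |(if i ∈ S then d else a) x|)
    _ ≤ ∏ i, (if i ∈ S then ∫ x, |d x| ∂μ else 1) := by
        refine Finset.prod_le_prod (fun i _ => integral_nonneg fun x => abs_nonneg _) fun i _ => ?_
        split_ifs
        · exact le_rfl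
        · exact ha1
    _ = (∫ x, |d x| ∂μ) ^ S.card := by simp

lemma diagForm_add (hm : Measurable h) (hb : ∀ z, |h z| ≤ 1) (hd : Integrable d μ)
    (ha : Integrable a μ) :
    diagForm μ h (a + d) = ∑ S : Finset (Fin n), mixedForm μ h S d a := by
  simp only [diagForm, mixedForm]
  rw [← integral_finsetSum _ fun S _ =>
    integrable_kernel_mul_prod hm hb (integrable_ite_mem hd ha S)]
  refine integral_congr_ae (ae_of_all _ fun z => ?_)
  simp only [Pi.add_apply, ← Finset.mul_sum]
  congr 1
  simp_rw [add_comm (a _), Finset.prod_add, Finset.powerset_univ]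
  refine Finset.sum_congr rfl fun S _ => ?_
  have : ∀ i, (if i ∈ S then d else a) (z i) = if i ∈ S then d (z i) else a (z i) := by
    intro i; split_ifs <;> rfl
  simp [this, Finset.prod_ite, Finset.filter_notMem_eq_sdiff]

lemma abs_diagForm_add_sub_le (hm : Measurable h) (hb : ∀ z, |h z| ≤ 1) (hd : Integrable d μ)
    (ha : Integrable a μ) (ha1 : ∫ x, |a x| ∂μ ≤ 1) (hd1 : ∫ x, |d x| ∂μ ≤ 1) :
    |diagForm μ h (a + d) - diagForm μ h a| ≤ 2 ^ n * ∫ x, |d x| ∂μ := by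
  have h0 : diagForm μ h a = ∑ S : Finset (Fin n), if S = ∅ then mixedForm μ h S d a else 0 := by
    simp [mixedForm_empty]
  have hδ : 0 ≤ ∫ x, |d x| ∂μ := integral_nonneg fun x => abs_nonneg _
  rw [diagForm_add hm hb hd ha, h0, ← Finset.sum_sub_distrib]
  refine (Finset.abs_sum_le_sum_abs _ _).trans ?_
  refine (Finset.sum_le_card_nsmul _ _ (∫ x, |d x| ∂μ) fun S _ => ?_).trans_eq (by simp)
  split_ifs with hS
  · simpa using hδ
  · simpa using (abs_mixedForm_le hm hb hd ha ha1 S).trans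
      (pow_le_of_le_one hδ hd1 (by simpa using hS))

lemma abs_diagForm_add_sub_linForm_le (hm : Measurable h) (hb : ∀ z, |h z| ≤ 1)
    (hd : Integrable d μ) (ha : Integrable a μ) (ha1 : ∫ x, |a x| ∂μ ≤ 1)
    (hd1 : ∫ x, |d x| ∂μ ≤ 1) :
    |diagForm μ h (a + d) - diagForm μ h a - linForm μ h d a| ≤
      2 ^ n * (∫ x, |d x| ∂μ) ^ 2 := by
  have h0 : diagForm μ h a = ∑ S : Finset (Fin n), if S = ∅ then mixedForm μ h S d a else 0 := by
    simp [mixedForm_empty]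
  have hδ : 0 ≤ ∫ x, |d x| ∂μ := integral_nonneg fun x => abs_nonneg _
  rw [diagForm_add hm hb hd ha, h0, linForm, ← Finset.sum_sub_distrib, ← Finset.sum_sub_distrib]
  refine (Finset.abs_sum_le_sum_abs _ _).trans ?_
  refine (Finset.sum_le_card_nsmul _ _ ((∫ x, |d x| ∂μ) ^ 2) fun S _ => ?_).trans_eq (by simp)
  by_cases hS : S = ∅
  · simpa [hS] using sq_nonneg _
  by_cases hS1 : S.card = 1
  · simpa [hS, hS1] using sq_nonneg _
  have h2 : 2 ≤ S.card := by
    have := Finset.card_ne_zero.2 (Finset.nonempty_iff_ne_empty.2 hS)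
    omega
  simpa [hS, hS1] using (abs_mixedForm_le hm hb hd ha ha1 S).trans
    (pow_le_pow_of_le_one hδ hd1 h2)

lemma abs_diagForm_add_add_diagForm_sub_le (hm : Measurable h) (hb : ∀ z, |h z| ≤ 1)
    (hd : Integrable d μ) (ha : Integrable a μ) (ha1 : ∫ x, |a x| ∂μ ≤ 1)
    (hd1 : ∫ x, |d x| ∂μ ≤ 1) :
    |diagForm μ h (a + d) + diagForm μ h (a - d) - 2 * diagForm μ h a| ≤
      2 * 2 ^ n * (∫ x, |d x| ∂μ) ^ 2 := by
  have h1 := abs_diagForm_add_sub_linForm_le hm hb hd ha ha1 hd1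
  have h2 := abs_diagForm_add_sub_linForm_le hm hb hd.neg ha ha1 (by simpa using hd1)
  rw [linForm_neg, ← sub_eq_add_neg] at h2
  simp only [Pi.neg_apply, abs_neg] at h2
  rw [abs_le] at *
  constructor <;> linarith [h1.1, h1.2, h2.1, h2.2]

end MultilinearForms

section KLFun

open InformationTheory

lemma sq_sub_one_div_six_le_klFun {y : ℝ} (h0 : 0 ≤ y) (h2 : y ≤ 2) :
    (y - 1) ^ 2 / 6 ≤ klFun y := by
  rcases h0.eq_or_lt with rfl | hy
  · norm_num [klFun_zero]
  have hs : 0 < √y := Real.sqrt_pos.2 hy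
  have hsq : √y ^ 2 = y := Real.sq_sqrt hy.le
  have hlog : 1 - (√y)⁻¹ ≤ Real.log √y := Real.one_sub_inv_le_log_of_pos hs
  rw [Real.log_sqrt hy.le] at hlog
  have h3 : 2 * y - 2 * √y ≤ y * Real.log y := by
    have := mul_le_mul_of_nonneg_left hlog (by positivity : 0 ≤ 2 * y)
    have e : 2 * y * (1 - (√y)⁻¹) = 2 * y - 2 * √y := by
      nth_rw 1 [← hsq]
      nth_rw 3 [← hsq]
      field_simp
    linarith
  have hs2 : √y ≤ 1.42 := by
    rw [Real.sqrt_le_left (by norm_num)]; norm_num; linarith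
  have h4 : (y - 1) ^ 2 = (√y - 1) ^ 2 * (√y + 1) ^ 2 := by rw [← hsq]; simp; ring
  have h5 : (√y + 1) ^ 2 ≤ 6 := by nlinarith
  have h6 : (√y - 1) ^ 2 ≤ klFun y := by
    rw [klFun_apply]; nlinarith
  nlinarith [sq_nonneg (√y - 1)]

lemma klFun_midpoint_add_le {a b : ℝ} (ha : 0 ≤ a) (hb : 0 ≤ b) (l : ℝ) :
    klFun ((a + b) / 2) + (2 * l * |a - b| - l ^ 2 * (a + b)) / 12 ≤
      (klFun a + klFun b) / 2 := by
  rcases (add_nonneg ha hb).eq_or_lt with h | h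
  · obtain rfl : a = 0 := by linarith
    obtain rfl : b = 0 := by linarith
    simp
  set m := (a + b) / 2 with hmdef
  have hm : 0 < m := by positivity
  have key : ∀ c, 0 ≤ c → c ≤ 2 * m → klFun c = m * klFun (c / m) + c * Real.log m + 1 - m := by
    intro c hc _
    rcases hc.eq_or_lt with rfl | hc
    · simp [klFun_zero]
    · rw [klFun_apply, klFun_apply, Real.log_div hc.ne' hm.ne']
      field_simp
      ring
  have ham : a ≤ 2 * m := by linarith
  have hbm : b ≤ 2 * m := by linarith
  have h1 := sq_sub_one_div_six_le_klFun (y := a / m) (by positivity) (by rwa [div_le_iff₀ hm])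
  have h2 := sq_sub_one_div_six_le_klFun (y := b / m) (by positivity) (by rwa [div_le_iff₀ hm])
  have h1' := mul_le_mul_of_nonneg_left h1 hm.le
  have h2' := mul_le_mul_of_nonneg_left h2 hm.le
  rw [key a ha ham, key b hb hbm, klFun_apply m]
  have e1 : m * ((a / m - 1) ^ 2 / 6) = (a - b) ^ 2 / (24 * m) := by
    have : a - b = 2 * (a - m) := by rw [hmdef]; ring
    rw [this]; field_simp; ring
  have e2 : m * ((b / m - 1) ^ 2 / 6) = (a - b) ^ 2 / (24 * m) := by
    have : a - b = -2 * (b - m) := by rw [hmdef]; ring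
    rw [this]; field_simp; ring
  have hab : a + b = 2 * m := by rw [hmdef]; ring
  have e3 : (2 * l * |a - b| - l ^ 2 * (a + b)) / 12 ≤ (a - b) ^ 2 / (24 * m) := by
    rw [hab, ← sq_abs (a - b), div_le_div_iff₀ (by norm_num) (by positivity)]
    nlinarith [sq_nonneg (|a - b| - 2 * m * l)]
  have e4 : a * Real.log m + b * Real.log m = 2 * (m * Real.log m) := by
    rw [← add_mul, hab]; ring
  rw [e1] at h1'
  rw [e2] at h2'
  linarith

lemma klFun_one_add_le_sq {x : ℝ} (hx : -1 < x) : klFun (1 + x) ≤ x ^ 2 := by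
  have h : 0 < 1 + x := by linarith
  have := mul_le_mul_of_nonneg_left (Real.log_le_sub_one_of_pos h) h.le
  rw [klFun_apply]
  nlinarith

end KLFun

section Variational

open InformationTheory

variable {Ω : Type*} [MeasurableSpace Ω]

/-- Probability densities of finite relative entropy. -/
structure IsAdmissible (μ : Measure Ω) (f : Ω → ℝ) : Prop where
  measurable : Measurable f
  nonneg : ∀ x, 0 ≤ f x
  integrable : Integrable f μ
  integral_eq_one : ∫ x, f x ∂μ = 1
  integrable_klFun : Integrable (fun x => klFun (f x)) μ

/-- The objective `θ t(f) - D(f)` at a density `f`. -/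
def objective {n : ℕ} (μ : Measure Ω) (h : (Fin n → Ω) → ℝ) (θ : ℝ) (f : Ω → ℝ) : ℝ :=
  θ * diagForm μ h f - ∫ x, klFun (f x) ∂μ

variable {μ : Measure Ω} {n : ℕ} {h : (Fin n → Ω) → ℝ} {f g : Ω → ℝ} {θ : ℝ}

lemma IsAdmissible.integral_abs (hf : IsAdmissible μ f) : ∫ x, |f x| ∂μ = 1 := by
  simp_rw [abs_of_nonneg (hf.nonneg _), hf.integral_eq_one]

lemma integral_klFun_nonneg (hf : ∀ x, 0 ≤ f x) : 0 ≤ ∫ x, klFun (f x) ∂μ :=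
  integral_nonneg fun x => klFun_nonneg (hf x)

lemma IsAdmissible.midpoint (hf : IsAdmissible μ f) (hg : IsAdmissible μ g) :
    IsAdmissible μ (fun x => (f x + g x) / 2) where
  measurable := (hf.measurable.add hg.measurable).div_const 2
  nonneg x := by have := hf.nonneg x; have := hg.nonneg x; positivity
  integrable := (hf.integrable.add hg.integrable).div_const 2
  integral_eq_one := by
    rw [integral_div, integral_add hf.integrable hg.integrable, hf.integral_eq_one,
      hg.integral_eq_one]
    norm_num
  integrable_klFun := by
    refine ((hf.integrable_klFun.add hg.integrable_klFun).div_const 2).mono'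
      (measurable_klFun.comp ((hf.measurable.add hg.measurable).div_const 2)).aestronglyMeasurable
      (ae_of_all _ fun x => ?_)
    have h0 : 0 ≤ (f x + g x) / 2 := by
      have := hf.nonneg x; have := hg.nonneg x; positivity
    rw [Real.norm_of_nonneg (klFun_nonneg h0)]
    simpa using klFun_midpoint_add_le (hf.nonneg x) (hg.nonneg x) 0

lemma IsAdmissible.integral_klFun_midpoint_add_le (hf : IsAdmissible μ f)
    (hg : IsAdmissible μ g) :
    ∫ x, klFun ((f x + g x) / 2) ∂μ + (∫ x, |f x - g x| ∂μ) ^ 2 / 24 ≤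
      (∫ x, klFun (f x) ∂μ + ∫ x, klFun (g x) ∂μ) / 2 := by
  set δ := ∫ x, |f x - g x| ∂μ with hδ
  have hi1 : Integrable (fun x => 2 * (δ / 2) * |f x - g x|) μ :=
    (hf.integrable.sub hg.integrable).abs.const_mul _
  have hi2 : Integrable (fun x => (δ / 2) ^ 2 * (f x + g x)) μ :=
    (hf.integrable.add hg.integrable).const_mul _
  have hi3 : Integrable
      (fun x => (2 * (δ / 2) * |f x - g x| - (δ / 2) ^ 2 * (f x + g x)) / 12) μ :=
    (hi1.sub hi2).div_const 12
  have key := integral_mono (μ := μ)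
    ((hf.midpoint hg).integrable_klFun.add hi3)
    ((hf.integrable_klFun.add hg.integrable_klFun).div_const 2)
    (fun x => klFun_midpoint_add_le (hf.nonneg x) (hg.nonneg x) (δ / 2))
  simp only [Pi.add_apply] at key
  rw [integral_add (hf.midpoint hg).integrable_klFun hi3,
    integral_div, integral_sub hi1 hi2, integral_const_mul, integral_const_mul,
    integral_add hf.integrable hg.integrable, hf.integral_eq_one, hg.integral_eq_one,
    integral_div, integral_add hf.integrable_klFun hg.integrable_klFun, ← hδ] at key
  linarith

variable [IsProbabilityMeasure μ]

lemma isAdmissible_one : IsAdmissible μ (1 : Ω → ℝ) where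
  measurable := measurable_const
  nonneg _ := zero_le_one
  integrable := integrable_const 1
  integral_eq_one := by simp
  integrable_klFun := by simp

lemma abs_diagForm_le_one (hm : Measurable h) (hb : ∀ z, |h z| ≤ 1) (hf : IsAdmissible μ f) :
    |diagForm μ h f| ≤ 1 := by
  simpa [mixedForm_empty] using
    abs_mixedForm_le hm hb hf.integrable hf.integrable hf.integral_abs.le ∅

lemma objective_le_abs (hm : Measurable h) (hb : ∀ z, |h z| ≤ 1) (hf : IsAdmissible μ f) :
    objective μ h θ f ≤ |θ| := by
  have h1 : θ * diagForm μ h f ≤ |θ| := by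
    refine (le_abs_self _).trans ?_
    rw [abs_mul]
    exact mul_le_of_le_one_right (abs_nonneg θ) (abs_diagForm_le_one hm hb hf)
  have h2 := integral_klFun_nonneg (μ := μ) hf.nonneg
  rw [objective]
  linarith

lemma objective_midpoint (hm : Measurable h) (hb : ∀ z, |h z| ≤ 1)
    (hθ : |θ| ≤ 1 / (12 * 2 ^ n)) (hf : IsAdmissible μ f) (hg : IsAdmissible μ g) :
    (objective μ h θ f + objective μ h θ g) / 2 + (∫ x, |f x - g x| ∂μ) ^ 2 / 48 ≤
      objective μ h θ (fun x => (f x + g x) / 2) := by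
  have hent := hf.integral_klFun_midpoint_add_le hg
  set a : Ω → ℝ := fun x => (f x + g x) / 2 with ha
  set d : Ω → ℝ := fun x => (f x - g x) / 2 with hd
  have hdi : Integrable d μ := (hf.integrable.sub hg.integrable).div_const 2
  have hδ : ∫ x, |d x| ∂μ = (∫ x, |f x - g x| ∂μ) / 2 := by
    simp [hd, abs_div, integral_div]
  have hδ2 : ∫ x, |f x - g x| ∂μ ≤ 2 := by
    have := integral_mono (μ := μ) (hf.integrable.sub hg.integrable).abs
      (hf.integrable.abs.add hg.integrable.abs) (fun x => abs_sub (f x) (g x))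
    simp only [Pi.add_apply, Pi.sub_apply] at this
    rw [integral_add hf.integrable.abs hg.integrable.abs, hf.integral_abs, hg.integral_abs] at this
    linarith
  have hquad := abs_diagForm_add_add_diagForm_sub_le hm hb hdi (hf.midpoint hg).integrable
    (hf.midpoint hg).integral_abs.le (by rw [hδ]; linarith)
  rw [show a + d = f by ext x; simp [ha, hd]; ring, show a - d = g by ext x; simp [ha, hd]; ring,
    hδ] at hquad
  set δ := ∫ x, |f x - g x| ∂μ
  have hθ' : |θ| * (2 * 2 ^ n * (δ / 2) ^ 2) ≤ δ ^ 2 / 24 := by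
    calc |θ| * (2 * 2 ^ n * (δ / 2) ^ 2)
        ≤ 1 / (12 * 2 ^ n) * (2 * 2 ^ n * (δ / 2) ^ 2) := by gcongr
      _ = δ ^ 2 / 24 := by field_simp; ring
  have habs : |θ * (diagForm μ h f + diagForm μ h g - 2 * diagForm μ h a)| ≤ δ ^ 2 / 24 := by
    rw [abs_mul]
    exact (mul_le_mul_of_nonneg_left hquad (abs_nonneg θ)).trans hθ'
  have := (abs_le.1 habs).2
  simp only [objective]
  linarith

lemma exists_maximizing_limit (hm : Measurable h) (hb : ∀ z, |h z| ≤ 1) {F : ℕ → Ω → ℝ} {s : ℝ}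
    (hF : ∀ m, IsAdmissible μ (F m))
    (hs : Tendsto (fun m => objective μ h θ (F m)) atTop (𝓝 s))
    (hcau : ∀ N m p, N ≤ m → N ≤ p → ∫ x, |F m x - F p x| ∂μ ≤ (1 / 2) ^ N) :
    ∃ f, IsAdmissible μ f ∧ s ≤ objective μ h θ f := by
  obtain ⟨f₀, hf₀, hlim₀⟩ := Lp.cauchy_complete_eLpNorm (μ := μ) le_rfl
    (fun m => memLp_one_iff_integrable.2 (hF m).integrable)
    (B := fun N => ENNReal.ofReal (2 * (1 / 2) ^ N))
    ((summable_geometric_two.mul_left 2).tsum_ofReal_ne_top)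
    (fun N m p hm hp => by
      rw [eLpNorm_one_eq_lintegral_enorm]
      simp_rw [← ofReal_norm]
      rw [← ofReal_integral_eq_lintegral_ofReal
        ((hF m).integrable.sub (hF p).integrable).norm (ae_of_all _ fun x => norm_nonneg _)]
      refine (ENNReal.ofReal_lt_ofReal_iff (by positivity)).2 ?_
      simp only [Pi.sub_apply, Real.norm_eq_abs]
      have : (0 : ℝ) < (1 / 2) ^ N := by positivity
      linarith [hcau N m p hm hp])
  obtain ⟨ns, hns, hae⟩ := (tendstoInMeasure_of_tendsto_eLpNorm one_ne_zero
    (fun m => (hF m).measurable.aestronglyMeasurable) hf₀.1 hlim₀).exists_seq_tendsto_ae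
  set f : Ω → ℝ := fun x => max (hf₀.1.mk f₀ x) 0 with hfdef
  have hff₀ : f =ᵐ[μ] f₀ := by
    filter_upwards [hae, hf₀.1.ae_eq_mk] with x hx hmk
    simp only [hfdef, ← hmk]
    exact max_eq_left (ge_of_tendsto' hx fun i => (hF _).nonneg x)
  have hfm : Measurable f := hf₀.1.stronglyMeasurable_mk.measurable.max measurable_const
  have hfi : Integrable f μ := (memLp_one_iff_integrable.1 hf₀).congr hff₀.symm
  have hf0 : ∀ x, 0 ≤ f x := fun x => le_max_right _ _
  have hL1 : Tendsto (fun m => ∫ x, |F m x - f x| ∂μ) atTop (𝓝 0) := by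
    have := (ENNReal.tendsto_toReal ENNReal.zero_ne_top).comp hlim₀
    refine this.congr fun m => ?_
    have e : ∫ x, |F m x - f x| ∂μ = ∫ x, ‖(F m - f₀) x‖ ∂μ := by
      refine integral_congr_ae ?_
      filter_upwards [hff₀] with x hx
      simp [hx]
    rw [e, integral_norm_eq_lintegral_enorm
      ((hF m).measurable.aestronglyMeasurable.sub hf₀.1), Function.comp_apply,
      eLpNorm_one_eq_lintegral_enorm]
  have hf1 : ∫ x, f x ∂μ = 1 := by
    have h1 : Tendsto (fun _ : ℕ => |1 - ∫ x, f x ∂μ|) atTop (𝓝 0) := by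
      refine squeeze_zero (fun m => abs_nonneg _) (fun m => ?_) hL1
      rw [← (hF m).integral_eq_one, ← integral_sub (hF m).integrable hfi]
      exact abs_integral_le_integral_abs
    have h2 := tendsto_nhds_unique h1 tendsto_const_nhds
    have := abs_eq_zero.1 h2.symm
    linarith
  have hT : Tendsto (fun m => diagForm μ h (F m)) atTop (𝓝 (diagForm μ h f)) := by
    rw [tendsto_iff_dist_tendsto_zero]
    have hL1' : Tendsto (fun m => 2 ^ n * ∫ x, |F m x - f x| ∂μ) atTop (𝓝 0) := by
      simpa using hL1.const_mul (2 ^ n)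
    refine squeeze_zero' (Eventually.of_forall fun m => dist_nonneg) ?_ hL1'
    filter_upwards [hL1.eventually_le_const zero_lt_one] with m hm1
    rw [Real.dist_eq]
    have := abs_diagForm_add_sub_le hm hb ((hF m).integrable.sub hfi) hfi
      (by simp_rw [abs_of_nonneg (hf0 _), hf1]; rfl) hm1
    rwa [add_sub_cancel] at this
  have hE : Tendsto (fun m => ∫ x, klFun (F m x) ∂μ) atTop (𝓝 (θ * diagForm μ h f - s)) := by
    refine ((hT.const_mul θ).sub hs).congr fun m => ?_
    rw [objective]; ring
  have hE0 : 0 ≤ θ * diagForm μ h f - s :=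
    ge_of_tendsto' hE fun m => integral_klFun_nonneg (hF m).nonneg
  have hkm : Measurable fun x => klFun (f x) := measurable_klFun.comp hfm
  have hfatou : ∫⁻ x, ENNReal.ofReal (klFun (f x)) ∂μ ≤
      ENNReal.ofReal (θ * diagForm μ h f - s) := by
    calc ∫⁻ x, ENNReal.ofReal (klFun (f x)) ∂μ
        = ∫⁻ x, liminf (fun i => ENNReal.ofReal (klFun (F (ns i) x))) atTop ∂μ := by
          refine lintegral_congr_ae ?_
          filter_upwards [hae, hff₀] with x hx hx'
          rw [hx']
          exact (((ENNReal.continuous_ofReal.comp continuous_klFun).tendsto _).comp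
            hx).liminf_eq.symm
      _ ≤ liminf (fun i => ∫⁻ x, ENNReal.ofReal (klFun (F (ns i) x)) ∂μ) atTop :=
          lintegral_liminf_le fun i =>
            (measurable_klFun.comp (hF (ns i)).measurable).ennreal_ofReal
      _ = ENNReal.ofReal (θ * diagForm μ h f - s) := by
          refine Tendsto.liminf_eq ?_
          refine ((ENNReal.continuous_ofReal.tendsto _).comp
            (hE.comp hns.tendsto_atTop)).congr fun i => ?_
          exact ofReal_integral_eq_lintegral_ofReal (hF (ns i)).integrable_klFun
            (ae_of_all _ fun x => klFun_nonneg ((hF (ns i)).nonneg x))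
  have hki : Integrable (fun x => klFun (f x)) μ := by
    refine ⟨hkm.aestronglyMeasurable, ?_⟩
    rw [hasFiniteIntegral_iff_ofReal (ae_of_all _ fun x => klFun_nonneg (hf0 x))]
    exact hfatou.trans_lt ENNReal.ofReal_lt_top
  refine ⟨f, ⟨hfm, hf0, hfi, hf1, hki⟩, ?_⟩
  rw [← ofReal_integral_eq_lintegral_ofReal hki (ae_of_all _ fun x => klFun_nonneg (hf0 x)),
    ENNReal.ofReal_le_ofReal_iff hE0] at hfatou
  rw [objective]
  linarith

/-- For small `θ` the strongly concave objective has a maximizer, with quadratic growth. -/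
lemma exists_objective_add_sq_le (hm : Measurable h) (hb : ∀ z, |h z| ≤ 1)
    (hθ : |θ| ≤ 1 / (12 * 2 ^ n)) :
    ∃ f, IsAdmissible μ f ∧ ∀ g, IsAdmissible μ g →
      objective μ h θ g + (∫ x, |f x - g x| ∂μ) ^ 2 / 24 ≤ objective μ h θ f := by
  set V : Set ℝ := {v | ∃ g, IsAdmissible μ g ∧ objective μ h θ g = v} with hV
  have hbdd : BddAbove V := by
    refine ⟨|θ|, ?_⟩
    rintro _ ⟨g, hg, rfl⟩
    exact objective_le_abs hm hb hg
  have hne : V.Nonempty := ⟨_, 1, isAdmissible_one, rfl⟩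
  have hle : ∀ g, IsAdmissible μ g → objective μ h θ g ≤ sSup V := fun g hg =>
    le_csSup hbdd ⟨g, hg, rfl⟩
  have hex : ∀ m : ℕ, ∃ g, IsAdmissible μ g ∧
      sSup V - (1 / 4) ^ m / 48 < objective μ h θ g := by
    intro m
    obtain ⟨_, ⟨g, hg, rfl⟩, hlt⟩ := exists_lt_of_lt_csSup hne
      (show sSup V - (1 / 4) ^ m / 48 < sSup V from sub_lt_self _ (by positivity))
    exact ⟨g, hg, hlt⟩
  choose F hF hFs using hex
  have hq : Tendsto (fun m : ℕ => ((1 : ℝ) / 4) ^ m / 48) atTop (𝓝 0) := by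
    simpa using (tendsto_pow_atTop_nhds_zero_of_lt_one (r := (1 : ℝ) / 4) (by norm_num)
      (by norm_num)).div_const 48
  have hs : Tendsto (fun m => objective μ h θ (F m)) atTop (𝓝 (sSup V)) :=
    tendsto_of_tendsto_of_tendsto_of_le_of_le (by simpa using hq.const_sub (sSup V))
      tendsto_const_nhds (fun m => (hFs m).le) (fun m => hle _ (hF m))
  obtain ⟨f, hf, hfs⟩ := exists_maximizing_limit hm hb hF hs fun N m p hNm hNp => by
    have h1 := objective_midpoint hm hb hθ (hF m) (hF p)
    have h2 := hle _ ((hF m).midpoint (hF p))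
    have h3 : ((1 : ℝ) / 4) ^ m ≤ (1 / 4) ^ N :=
      pow_le_pow_of_le_one (by norm_num) (by norm_num) hNm
    have h4 : ((1 : ℝ) / 4) ^ p ≤ (1 / 4) ^ N :=
      pow_le_pow_of_le_one (by norm_num) (by norm_num) hNp
    refine le_of_sq_le_sq ?_ (by positivity)
    have e : (((1 : ℝ) / 2) ^ N) ^ 2 = (1 / 4) ^ N := by
      rw [← pow_mul, mul_comm, pow_mul]; norm_num
    rw [e]
    linarith [hFs m, hFs p]
  refine ⟨f, hf, fun g hg => ?_⟩
  have h1 := objective_midpoint hm hb hθ hf hg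
  have h2 := hle _ (hf.midpoint hg)
  linarith

end Variational

section Tilt

open InformationTheory

variable {Ω : Type*} [MeasurableSpace Ω]

/-- The conditional expectation `E[h | Z₀ = x]` of a kernel `h` under i.i.d. samples. -/
def firstProjection {k : ℕ} (μ : Measure Ω) (h : (Fin (k + 1) → Ω) → ℝ) (x : Ω) : ℝ :=
  ∫ w : Fin k → Ω, h (Fin.cons x w) ∂(Measure.pi fun _ => μ)

variable {μ : Measure Ω} [IsProbabilityMeasure μ] {k : ℕ} {h : (Fin (k + 1) → Ω) → ℝ}
  {u : Ω → ℝ} {θ : ℝ}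

lemma measurable_cons :
    Measurable fun p : Ω × (Fin k → Ω) => (Fin.cons p.1 p.2 : Fin (k + 1) → Ω) := by
  refine measurable_pi_lambda _ fun i => ?_
  refine Fin.cases ?_ (fun j => ?_) i
  · simpa using measurable_fst
  · simpa [Function.comp_def] using (measurable_pi_apply j).comp measurable_snd

lemma measurable_firstProjection (hm : Measurable h) : Measurable (firstProjection μ h) :=
  (StronglyMeasurable.integral_prod_right
    (f := fun (x : Ω) (w : Fin k → Ω) => h (Fin.cons x w))
    (hm.comp measurable_cons).stronglyMeasurable).measurable

lemma abs_firstProjection_le (hb : ∀ z, |h z| ≤ 1) (x : Ω) : |firstProjection μ h x| ≤ 1 := by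
  have := norm_integral_le_of_norm_le_const (μ := Measure.pi fun _ : Fin k => μ)
    (f := fun w : Fin k → Ω => h (Fin.cons x w)) (C := 1) (ae_of_all _ fun w => by simpa using hb _)
  simpa [firstProjection] using this

lemma integral_mul_apply_zero (hm : Measurable h) (hb : ∀ z, |h z| ≤ 1) (hu : Integrable u μ) :
    ∫ z, h z * u (z 0) ∂(Measure.pi fun _ : Fin (k + 1) => μ) =
      ∫ x, u x * firstProjection μ h x ∂μ := by
  have hmp := (measurePreserving_piFinSuccAbove (fun _ : Fin (k + 1) => μ) 0).symm
  have hint : Integrable (fun z => h z * u (z 0)) (Measure.pi fun _ : Fin (k + 1) => μ) :=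
    (integrable_comp_eval (μ := fun _ : Fin (k + 1) => μ) (i := 0) hu).bdd_mul (c := 1)
      hm.aestronglyMeasurable (ae_of_all _ fun z => by simpa using hb z)
  have hint' := hmp.integrable_comp_of_integrable hint
  simp only [Function.comp_def] at hint'
  rw [← hmp.integral_comp' (g := fun z => h z * u (z 0)), integral_prod _ hint']
  refine integral_congr_ae (ae_of_all _ fun x => ?_)
  simp only [firstProjection, ← integral_const_mul]
  refine integral_congr_ae (ae_of_all _ fun w => ?_)
  have e : (MeasurableEquiv.piFinSuccAbove (fun _ : Fin (k + 1) => Ω) 0).symm (x, w) =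
      Fin.cons x w := by
    simp [MeasurableEquiv.piFinSuccAbove, Fin.consEquiv]
  simp [e, mul_comm]

lemma integral_mul_apply (hm : Measurable h) (hb : ∀ z, |h z| ≤ 1)
    (hsymm : ∀ (e : Equiv.Perm (Fin (k + 1))) z, h (z ∘ e) = h z) (hu : Integrable u μ)
    (i : Fin (k + 1)) :
    ∫ z, h z * u (z i) ∂(Measure.pi fun _ : Fin (k + 1) => μ) =
      ∫ x, u x * firstProjection μ h x ∂μ := by
  rw [← integral_mul_apply_zero hm hb hu]
  have hmp := measurePreserving_piCongrLeft (fun _ : Fin (k + 1) => μ) (Equiv.swap 0 i)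
  rw [← hmp.integral_comp' (g := fun z => h z * u (z 0))]
  refine integral_congr_ae (ae_of_all _ fun z => ?_)
  have e : (MeasurableEquiv.piCongrLeft (fun _ : Fin (k + 1) => Ω) (Equiv.swap 0 i)) z =
      z ∘ Equiv.swap 0 i := by
    ext j
    obtain ⟨j, rfl⟩ := (Equiv.swap 0 i).surjective j
    rw [MeasurableEquiv.piCongrLeft_apply_apply]
    simp
  simp only [e, hsymm]
  simp

lemma linForm_one (hm : Measurable h) (hb : ∀ z, |h z| ≤ 1)
    (hsymm : ∀ (e : Equiv.Perm (Fin (k + 1))) z, h (z ∘ e) = h z) (hu : Integrable u μ) :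
    linForm μ h u 1 = (k + 1) * ∫ x, u x * firstProjection μ h x ∂μ := by
  have key : linForm μ h u 1 = ∑ S : Finset (Fin (k + 1)),
      if S.card = 1 then ∫ x, u x * firstProjection μ h x ∂μ else 0 := by
    refine Finset.sum_congr rfl fun S _ => ?_
    split_ifs with hS
    · obtain ⟨i, rfl⟩ := Finset.card_eq_one.1 hS
      rw [← integral_mul_apply hm hb hsymm hu i, mixedForm]
      refine integral_congr_ae (ae_of_all _ fun z => ?_)
      simp only
      rw [Finset.prod_eq_single i]
      · simp
      · intro j _ hj
        simp [hj]
      · simp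
    · rfl
  rw [key, ← Finset.sum_filter, Finset.sum_const, Finset.univ_filter_card_eq,
    Finset.card_powersetCard]
  simp

lemma isAdmissible_one_add (hu : Measurable u) (hu1 : ∀ x, |u x| ≤ 1) (hu0 : ∫ x, u x ∂μ = 0)
    {s : ℝ} (hs : |s| ≤ 1 / 2) :
    IsAdmissible μ (fun x => 1 + s * u x) ∧ ∫ x, klFun (1 + s * u x) ∂μ ≤ s ^ 2 := by
  have hui : Integrable u μ := Integrable.of_bound hu.aestronglyMeasurable 1 (ae_of_all _ hu1)
  have hsu : ∀ x, |s * u x| ≤ 1 / 2 := fun x => by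
    rw [abs_mul]
    nlinarith [hu1 x, abs_nonneg s, abs_nonneg (u x)]
  have h0 : ∀ x, 0 ≤ 1 + s * u x := fun x => by linarith [(abs_le.1 (hsu x)).1]
  have hk : ∀ x, klFun (1 + s * u x) ≤ s ^ 2 := fun x => by
    refine (klFun_one_add_le_sq (by linarith [(abs_le.1 (hsu x)).1])).trans ?_
    rw [mul_pow]
    exact mul_le_of_le_one_right (sq_nonneg s) ((sq_le_one_iff_abs_le_one _).2 (hu1 x))
  have hmeas : Measurable fun x => 1 + s * u x := (hu.const_mul s).const_add 1
  have hki : Integrable (fun x => klFun (1 + s * u x)) μ :=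
    Integrable.of_bound (measurable_klFun.comp hmeas).aestronglyMeasurable (s ^ 2)
      (ae_of_all _ fun x => by rw [Real.norm_of_nonneg (klFun_nonneg (h0 x))]; exact hk x)
  refine ⟨⟨hmeas, h0, (integrable_const 1).add (hui.const_mul s), ?_, hki⟩, ?_⟩
  · rw [integral_add (integrable_const 1) (hui.const_mul s), integral_const_mul, hu0]
    simp
  · simpa using integral_mono hki (integrable_const (s ^ 2)) hk

/-- If the first projection of a symmetric kernel is not a.s. constant, tilting the uniform density
along it strictly increases the objective. -/
lemma exists_lt_objective (hm : Measurable h) (hb : ∀ z, |h z| ≤ 1)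
    (hsymm : ∀ (e : Equiv.Perm (Fin (k + 1))) z, h (z ∘ e) = h z) (hθ : θ ≠ 0)
    (hne : ¬ ∀ᵐ x ∂μ, firstProjection μ h x = ∫ y, firstProjection μ h y ∂μ) :
    ∃ g, IsAdmissible μ g ∧ θ * diagForm μ h 1 < objective μ h θ g := by
  set p := firstProjection μ h with hp
  set c := ∫ y, p y ∂μ with hc
  have hpm : Measurable p := measurable_firstProjection hm
  have hp1 : ∀ x, |p x| ≤ 1 := abs_firstProjection_le hb
  have hpi : Integrable p μ := Integrable.of_bound hpm.aestronglyMeasurable 1 (ae_of_all _ hp1)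
  have hc1 : |c| ≤ 1 := by
    simpa using norm_integral_le_of_norm_le_const (μ := μ) (f := p) (ae_of_all _ hp1)
  set u : Ω → ℝ := fun x => (p x - c) / 2 with hu
  have hum : Measurable u := (hpm.sub_const c).div_const 2
  have hu1 : ∀ x, |u x| ≤ 1 := fun x => by
    have h1 := abs_le.1 (hp1 x)
    have h2 := abs_le.1 hc1
    rw [abs_le]
    constructor <;> simp only [hu] <;> linarith [h1.1, h1.2, h2.1, h2.2]
  have hui : Integrable u μ := Integrable.of_bound hum.aestronglyMeasurable 1 (ae_of_all _ hu1)
  have hu0 : ∫ x, u x ∂μ = 0 := by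
    rw [integral_div, integral_sub hpi (integrable_const c)]
    simp [hc]
  have hu2i : Integrable (fun x => u x ^ 2) μ :=
    Integrable.of_bound (hum.pow_const 2).aestronglyMeasurable 1
      (ae_of_all _ fun x => by simpa using hu1 x)
  set v := ∫ x, u x ^ 2 ∂μ with hv
  have hup : ∫ x, u x * p x ∂μ = 2 * v := by
    have e : ∀ x, u x * p x = 2 * u x ^ 2 + c * u x := fun x => by simp only [hu]; ring
    simp_rw [e]
    rw [integral_add (hu2i.const_mul 2) (hui.const_mul c), integral_const_mul, integral_const_mul,
      hu0]
    simp [hv]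
  have hv0 : 0 < v := by
    refine (integral_nonneg fun x => sq_nonneg (u x)).lt_of_ne' fun hv0 => hne ?_
    filter_upwards [(integral_eq_zero_iff_of_nonneg (fun x => sq_nonneg (u x)) hu2i).1 hv0]
      with x hx
    have : u x = 0 := by simpa using hx
    simp only [hu] at this
    linarith
  have hv1 : v ≤ 1 := by
    simpa using integral_mono hu2i (integrable_const (1 : ℝ)) fun x =>
      (sq_le_one_iff_abs_le_one _).2 (hu1 x)
  set C := |θ| * 2 ^ (k + 1) + 1 with hC
  have hC1 : 1 ≤ C := by simp only [hC]; linarith [show 0 ≤ |θ| * 2 ^ (k + 1) by positivity]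
  set t := v / (2 * C * (1 + |θ|)) with ht
  have hθ0 : 0 ≤ |θ| := abs_nonneg θ
  have ht0 : 0 < t := by positivity
  have hCt : C * t ≤ v / 2 := by
    have : C * t = v / 2 / (1 + |θ|) := by simp only [ht]; field_simp
    rw [this]
    exact div_le_self (by positivity) (by linarith)
  have hst : |θ * t| ≤ 1 / 2 := by
    rw [abs_mul, abs_of_pos ht0, ht, mul_div_assoc', div_le_div_iff₀ (by positivity) (by norm_num)]
    nlinarith [mul_nonneg hθ0 hv0.le]
  set s := θ * t with hs
  obtain ⟨hadm, hent⟩ := isAdmissible_one_add (μ := μ) hum hu1 hu0 hst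
  refine ⟨_, hadm, ?_⟩
  have hsui : Integrable (fun x => s * u x) μ := hui.const_mul s
  have habs : ∫ x, |s * u x| ∂μ ≤ |s| := by
    simpa using integral_mono hsui.abs (integrable_const |s|) fun x => by
      simp only [abs_mul]
      exact mul_le_of_le_one_right (abs_nonneg s) (hu1 x)
  have hlin := abs_diagForm_add_sub_linForm_le hm hb hsui isAdmissible_one.integrable
    isAdmissible_one.integral_abs.le (habs.trans (by linarith))
  rw [linForm_one hm hb hsymm hsui] at hlin
  simp_rw [mul_assoc s] at hlin
  rw [integral_const_mul, ← hp, hup] at hlin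
  have hsq : (∫ x, |s * u x| ∂μ) ^ 2 ≤ s ^ 2 := by
    rw [← sq_abs s]
    exact pow_le_pow_left₀ (integral_nonneg fun x => abs_nonneg _) habs 2
  replace hlin := hlin.trans (mul_le_mul_of_nonneg_left hsq (by positivity))
  have hg : (1 : Ω → ℝ) + (fun x => s * u x) = fun x => 1 + s * u x := rfl
  rw [hg] at hlin
  set D := diagForm μ h (fun x => 1 + s * u x) with hD
  have h1 : |θ * (D - diagForm μ h 1 - (k + 1) * (s * (2 * v)))| ≤
      |θ| * (2 ^ (k + 1) * s ^ 2) := by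
    rw [abs_mul]
    exact mul_le_mul_of_nonneg_left hlin hθ0
  have h2 := (abs_le.1 h1).1
  have h3 : C * s ^ 2 ≤ v / 2 * (θ ^ 2 * t) := by
    have : C * s ^ 2 = C * t * (θ ^ 2 * t) := by rw [hs]; ring
    rw [this]
    exact mul_le_mul_of_nonneg_right hCt (by positivity)
  have hpos : 0 < v * (θ ^ 2 * t) := by positivity
  have h4 : v * (θ ^ 2 * t) * 2 ≤ θ * ((k + 1) * (s * (2 * v))) := by
    have : θ * ((k + 1) * (s * (2 * v))) = (k + 1) * (v * (θ ^ 2 * t) * 2) := by rw [hs]; ring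
    rw [this]
    exact le_mul_of_one_le_left (by positivity) (by linarith [(Nat.cast_nonneg k : (0 : ℝ) ≤ k)])
  rw [objective]
  simp only [hC] at h3
  linarith

end Tilt

section Densities

open InformationTheory

variable {Ω : Type*} [MeasurableSpace Ω] {μ : Measure Ω} {f g : Ω → ℝ}

lemma pi_withDensity_ofReal [IsProbabilityMeasure μ] (hf : IsAdmissible μ f) (n : ℕ) :
    (Measure.pi fun _ : Fin n => μ.withDensity fun x => ENNReal.ofReal (f x)) =
      (Measure.pi fun _ : Fin n => μ).withDensity fun z => ENNReal.ofReal (∏ i, f (z i)) := by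
  have : IsFiniteMeasure (μ.withDensity fun x => ENNReal.ofReal (f x)) :=
    isFiniteMeasure_withDensity_ofReal hf.integrable.2
  refine Measure.pi_eq fun s hs => ?_
  rw [withDensity_apply _ (MeasurableSet.univ_pi hs), Measure.restrict_pi_pi,
    ← ofReal_integral_eq_lintegral_ofReal
      (Integrable.fintype_prod_dep fun i => hf.integrable.restrict)
      (ae_of_all _ fun z => Finset.prod_nonneg fun i _ => hf.nonneg _),
    integral_fintype_prod_eq_prod (μ := fun i => μ.restrict (s i)) (fun _ => f),
    ENNReal.ofReal_prod_of_nonneg fun i _ => integral_nonneg hf.nonneg]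
  refine Finset.prod_congr rfl fun i _ => ?_
  rw [withDensity_apply _ (hs i), ofReal_integral_eq_lintegral_ofReal hf.integrable.restrict
    (ae_of_all _ hf.nonneg)]

lemma IsAdmissible.isProbabilityMeasure_withDensity (hf : IsAdmissible μ f) :
    IsProbabilityMeasure (μ.withDensity fun x => ENNReal.ofReal (f x)) := by
  constructor
  rw [withDensity_apply _ MeasurableSet.univ, Measure.restrict_univ,
    ← ofReal_integral_eq_lintegral_ofReal hf.integrable (ae_of_all _ hf.nonneg),
    hf.integral_eq_one, ENNReal.ofReal_one]

lemma withDensity_eq_of_integral_abs_sub_eq_zero (hf : IsAdmissible μ f) (hg : IsAdmissible μ g)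
    (h : ∫ x, |f x - g x| ∂μ = 0) :
    (μ.withDensity fun x => ENNReal.ofReal (g x)) =
      μ.withDensity fun x => ENNReal.ofReal (f x) := by
  refine withDensity_congr_ae ?_
  filter_upwards [(integral_eq_zero_iff_of_nonneg (fun x => abs_nonneg _)
    (hf.integrable.sub hg.integrable).abs).1 h] with x hx
  have : f x - g x = 0 := by simpa using hx
  rw [sub_eq_zero.1 this]

end Densities

section Patterns

open InformationTheory

variable {k : ℕ} {σ : Equiv.Perm (Fin k)} {μ : Measure Ω2} {f : Ω2 → ℝ}

lemma measurable_hPat (σ : Equiv.Perm (Fin k)) : Measurable (hPat σ) := by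
  classical
  refine Measurable.ite ?_ measurable_const measurable_const
  simp only [StrictMono, Set.ofPred_exists, Set.ofPred_and, Set.ofPred_forall]
  refine MeasurableSet.iUnion fun τ => MeasurableSet.inter ?_ ?_ <;>
  · refine MeasurableSet.iInter fun i => MeasurableSet.iInter fun j => MeasurableSet.iInter fun _ =>
      measurableSet_lt ?_ ?_ <;> fun_prop

lemma abs_hPat_le_one (σ : Equiv.Perm (Fin k)) (z : Fin k → Ω2) : |hPat σ z| ≤ 1 := by
  unfold hPat
  split_ifs <;> simp

lemma hPat_nonneg (σ : Equiv.Perm (Fin k)) (z : Fin k → Ω2) : 0 ≤ hPat σ z := by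
  unfold hPat
  split_ifs <;> simp

lemma hPat_comp_perm (σ e : Equiv.Perm (Fin k)) (z : Fin k → Ω2) :
    hPat σ (z ∘ e) = hPat σ z := by
  unfold hPat
  congr 1
  refine propext ⟨?_, ?_⟩
  · rintro ⟨τ, h⟩
    exact ⟨e * τ, h⟩
  · rintro ⟨τ, h⟩
    exact ⟨e⁻¹ * τ, by simpa using h⟩

lemma tPat_eq_diagForm_one : tPat σ μ = diagForm μ (hPat σ) 1 := by
  simp [tPat, diagForm]

lemma tPat_withDensity [IsProbabilityMeasure μ] (hf : IsAdmissible μ f) :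
    tPat σ (μ.withDensity fun x => ENNReal.ofReal (f x)) = diagForm μ (hPat σ) f := by
  have hmeas : Measurable fun z : Fin k → Ω2 => ∏ i, f (z i) :=
    Finset.measurable_prod _ fun i _ => hf.measurable.comp (measurable_pi_apply i)
  rw [tPat, pi_withDensity_ofReal hf, integral_withDensity_eq_integral_toReal_smul
    hmeas.ennreal_ofReal (ae_of_all _ fun z => ENNReal.ofReal_lt_top)]
  refine integral_congr_ae (ae_of_all _ fun z => ?_)
  simp only [smul_eq_mul]
  rw [ENNReal.toReal_ofReal (Finset.prod_nonneg fun i _ => hf.nonneg _), mul_comm]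

lemma KL_withDensity [IsProbabilityMeasure μ] (hf : IsAdmissible μ f) :
    KL (μ.withDensity fun x => ENNReal.ofReal (f x)) μ =
      ENNReal.ofReal (∫ x, klFun (f x) ∂μ) := by
  rw [KL, if_pos (withDensity_absolutelyContinuous _ _), ofReal_integral_eq_lintegral_ofReal
    hf.integrable_klFun (ae_of_all _ fun x => klFun_nonneg (hf.nonneg x))]
  refine lintegral_congr_ae ?_
  filter_upwards [Measure.rnDeriv_withDensity μ hf.measurable.ennreal_ofReal] with x hx
  rw [hx, ENNReal.toReal_ofReal (hf.nonneg x), klFun_apply]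

lemma exists_isAdmissible_of_KL_ne_top {ν : Measure Ω2} [IsProbabilityMeasure μ]
    [IsProbabilityMeasure ν] (h : KL ν μ ≠ ∞) :
    ∃ g, IsAdmissible μ g ∧ (μ.withDensity fun x => ENNReal.ofReal (g x)) = ν := by
  have hac : ν ≪ μ := by
    by_contra hac
    exact h (if_neg hac)
  have hm : Measurable fun x => (ν.rnDeriv μ x).toReal :=
    (Measure.measurable_rnDeriv ν μ).ennreal_toReal
  refine ⟨fun x => (ν.rnDeriv μ x).toReal,
    ⟨hm, fun x => ENNReal.toReal_nonneg, Measure.integrable_toReal_rnDeriv, ?_,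
      (measurable_klFun.comp hm).aestronglyMeasurable, ?_⟩, ?_⟩
  · rw [Measure.integral_toReal_rnDeriv hac]
    simp
  · rw [hasFiniteIntegral_iff_ofReal (ae_of_all _ fun x => klFun_nonneg ENNReal.toReal_nonneg)]
    rw [KL, if_pos hac] at h
    exact h.lt_top
  · conv_rhs => rw [← Measure.withDensity_rnDeriv_eq ν μ hac]
    refine withDensity_congr_ae ?_
    filter_upwards [Measure.rnDeriv_lt_top ν μ] with x hx
    exact ENNReal.ofReal_toReal hx.ne

lemma coe_objective_eq [IsProbabilityMeasure μ] (hf : IsAdmissible μ f) (θ : ℝ) {ν : Measure Ω2}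
    (hν : (μ.withDensity fun x => ENNReal.ofReal (f x)) = ν) :
    ((θ * tPat σ ν : ℝ) : EReal) - ((KL ν μ : ℝ≥0∞) : EReal) =
      (objective μ (hPat σ) θ f : EReal) := by
  rw [← hν, tPat_withDensity hf, KL_withDensity hf, EReal.coe_ennreal_ofReal,
    max_eq_left (integral_klFun_nonneg hf.nonneg), objective, EReal.coe_sub]

lemma mem_Mcal_of_absolutelyContinuous {μ ν : ProbabilityMeasure Ω2} (hμ : μ ∈ Mcal)
    (h : (ν : Measure Ω2) ≪ μ) : ν ∈ Mcal := by
  obtain ⟨h1, h2, h3⟩ := hμ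
  have hsq : MeasurableSet unitSq := measurableSet_Icc.prod measurableSet_Icc
  refine ⟨?_, fun x => h.map measurable_fst (h2 x), fun y => h.map measurable_snd (h3 y)⟩
  exact (prob_compl_eq_zero_iff hsq).1 (h ((prob_compl_eq_zero_iff hsq).2 h1))

/-- A maximizer with quadratic growth among densities is the unique maximizer over `ℳ`. -/
lemma Fset_eq_singleton {μ ν : ProbabilityMeasure Ω2} (hμ : μ ∈ Mcal) {θ : ℝ}
    (hf : IsAdmissible (μ : Measure Ω2) f)
    (hν : ((μ : Measure Ω2).withDensity fun x => ENNReal.ofReal (f x)) = ν)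
    (hmax : ∀ g, IsAdmissible (μ : Measure Ω2) g →
      objective (μ : Measure Ω2) (hPat σ) θ g + (∫ x, |f x - g x| ∂(μ : Measure Ω2)) ^ 2 / 24 ≤
        objective (μ : Measure Ω2) (hPat σ) θ f) :
    Fset σ (μ : Measure Ω2) θ = {ν} := by
  have hνM : ν ∈ Mcal := mem_Mcal_of_absolutelyContinuous hμ
    (hν ▸ withDensity_absolutelyContinuous _ _)
  have hval := coe_objective_eq (σ := σ) hf θ hν
  have hsup : Fsup σ (μ : Measure Ω2) θ = (objective (μ : Measure Ω2) (hPat σ) θ f : EReal) := by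
    refine le_antisymm (iSup₂_le fun ρ _ => ?_) ?_
    · by_cases hKL : KL (ρ : Measure Ω2) μ = ∞
      · simp [hKL]
      · obtain ⟨g, hg, hgρ⟩ := exists_isAdmissible_of_KL_ne_top hKL
        rw [coe_objective_eq hg θ hgρ, EReal.coe_le_coe_iff]
        have := hmax g hg
        have := sq_nonneg (∫ x, |f x - g x| ∂(μ : Measure Ω2))
        linarith
    · rw [← hval]
      exact le_iSup₂ (f := fun (ρ : ProbabilityMeasure Ω2) (_ : ρ ∈ Mcal) =>
        ((θ * tPat σ (ρ : Measure Ω2) : ℝ) : EReal) - ((KL (↑ρ) (μ : Measure Ω2) : ℝ≥0∞) : EReal))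
        ν hνM
  refine Set.eq_singleton_iff_unique_mem.2 ⟨⟨hνM, hval.trans hsup.symm⟩, ?_⟩
  rintro ρ ⟨_, hρ⟩
  rw [hsup] at hρ
  have hKL : KL (ρ : Measure Ω2) μ ≠ ∞ := by
    intro hKL
    simp [hKL] at hρ
  obtain ⟨g, hg, hgρ⟩ := exists_isAdmissible_of_KL_ne_top hKL
  rw [coe_objective_eq hg θ hgρ, EReal.coe_eq_coe_iff] at hρ
  have h1 := hmax g hg
  have h2 : (∫ x, |f x - g x| ∂(μ : Measure Ω2)) = 0 := by
    refine pow_eq_zero_iff two_ne_zero |>.1 (le_antisymm ?_ (sq_nonneg _))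
    linarith
  apply Subtype.ext
  exact hgρ.symm.trans ((withDensity_eq_of_integral_abs_sub_eq_zero hf hg h2).trans hν)

end Patterns

/-- Proposition 1.12: for every `k` there is `θ_c > 0` depending only on
`k` such that if `σ` is a pattern of size `k+1` and `μ ∈ ℳ` is CNC with respect to `σ`, then
for each `θ ∈ (−θ_c,θ_c)` there is a unique maximizer `ν_θ`, `ν_θ ≠ μ` for `θ ≠ 0`, and
`t_σ(ν_θ) > t_σ(μ)` for `θ > 0` while `t_σ(ν_θ) < t_σ(μ)` for `θ < 0`. -/
theorem cnc_tilts_move (k : ℕ) :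
    ∃ θc > (0 : ℝ), ∀ (σ : Equiv.Perm (Fin (k + 1))) (μ : ProbabilityMeasure Ω2), μ ∈ Mcal →
      ¬ IsCC σ (↑μ) →
      ∀ θ ∈ Set.Ioo (-θc) θc,
        ∃ ν : ProbabilityMeasure Ω2, Fset σ (↑μ) θ = {ν} ∧
          (θ ≠ 0 → ν ≠ μ) ∧
          (0 < θ → tPat σ ((↑μ : Measure Ω2)) < tPat σ ((↑ν : Measure Ω2))) ∧
          (θ < 0 → tPat σ ((↑ν : Measure Ω2)) < tPat σ ((↑μ : Measure Ω2))) := by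
  refine ⟨1 / (12 * 2 ^ (k + 1)), by positivity, fun σ μ hμ hCC θ hθ => ?_⟩
  have hm := measurable_hPat σ
  have hb := abs_hPat_le_one σ
  obtain ⟨f, hf, hmax⟩ := exists_objective_add_sq_le (μ := (μ : Measure Ω2)) hm hb
    (abs_le.2 ⟨hθ.1.le, hθ.2.le⟩)
  let ν : ProbabilityMeasure Ω2 := ⟨_, hf.isProbabilityMeasure_withDensity⟩
  have hν : ((μ : Measure Ω2).withDensity fun x => ENNReal.ofReal (f x)) = ν := rfl
  have hne : ¬ ∀ᵐ x ∂(μ : Measure Ω2), firstProjection (μ : Measure Ω2) (hPat σ) x =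
      ∫ y, firstProjection (μ : Measure Ω2) (hPat σ) y ∂(μ : Measure Ω2) := fun hae => by
    refine hCC ⟨_, ⟨integral_nonneg fun y => integral_nonneg fun w => hPat_nonneg _ _, ?_⟩, hae⟩
    refine (le_abs_self _).trans ?_
    simpa [firstProjection] using norm_integral_le_of_norm_le_const (μ := (μ : Measure Ω2))
      (f := firstProjection (μ : Measure Ω2) (hPat σ)) (C := 1)
      (ae_of_all _ (abs_firstProjection_le (μ := (μ : Measure Ω2)) hb))
  have key : θ ≠ 0 → θ * tPat σ (μ : Measure Ω2) < θ * tPat σ (ν : Measure Ω2) := fun h0 => by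
    obtain ⟨g, hg, hlt⟩ := exists_lt_objective hm hb (hPat_comp_perm σ) h0 hne
    rw [tPat_eq_diagForm_one (μ := (μ : Measure Ω2)), ← hν, tPat_withDensity hf]
    refine hlt.trans_le ?_
    have h1 := hmax g hg
    have h2 := integral_klFun_nonneg (μ := (μ : Measure Ω2)) hf.nonneg
    have h3 := sq_nonneg (∫ x, |f x - g x| ∂(μ : Measure Ω2))
    rw [objective.eq_1 _ _ _ f] at h1
    linarith
  refine ⟨ν, Fset_eq_singleton hμ hf hν hmax, fun h0 h => ?_, fun h0 => ?_, fun h0 => ?_⟩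
  · have := key h0
    rw [h] at this
    exact lt_irrefl _ this
  · exact lt_of_mul_lt_mul_left (key h0.ne') h0.le
  · exact lt_of_mul_lt_mul_of_nonpos_left (key h0.ne) h0.le

end
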